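/- Let A ∈ ℝmax^{n×n} have λ(A) ≠ −∞, and let 𝒢 and 𝒢′ be two completely reducible subgraphs of the critical graph 𝒞(A), each with no trivial s.c.c., such that every s.c.c. of 𝒞(A) intersects 𝒢 if and only if it intersects 𝒢′. Then the CSR terms satisfy C_𝒢 S_𝒢^t R_𝒢 = C_{𝒢′} S_{𝒢′}^t R_{𝒢′} for all t ≥ 0; that is, CS^tR depends only on the set of s.c.c.'s of 𝒞(A) intersecting 𝒢. -/

import Mathlib

open Classical

noncomputable section

namespace MaxPlus

/-- A square matrix over the max-plus semiring `ℝmax = ℝ ∪ {-∞}`,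
represented as `WithBot ℝ` (with `⊥ = -∞`, `+` the usual addition). -/
abbrev MPMat (n : ℕ) := Fin n → Fin n → WithBot ℝ

variable {n : ℕ}

/-- Max-plus matrix multiplication: `(A⊗B)_{ij} = max_k (a_{ik} + b_{kj})`. -/
def mpMul (A B : MPMat n) : MPMat n := fun i j => Finset.univ.sup fun k => A i k + B k j

/-- Max-plus matrix power, with `A^0` the max-plus identity. -/
def mpPow (A : MPMat n) : ℕ → MPMat n
  | 0 => fun i j => if i = j then (0 : WithBot ℝ) else ⊥
  | t + 1 => mpMul A (mpPow A t)

/-- Max-plus matrix-vector product. -/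
def mpMulVec (A : MPMat n) (x : Fin n → WithBot ℝ) : Fin n → WithBot ℝ :=
  fun i => Finset.univ.sup fun k => A i k + x k

/-- A digraph on the node set `{1,…,n}`: a set of vertices together with an
edge relation. -/
structure SubD (n : ℕ) where
  verts : Set (Fin n)
  edge : Fin n → Fin n → Prop

/-- The weighted digraph `𝒟(A)` of a max-plus matrix: all `n` nodes, with an
edge `(i,j)` whenever `a_{ij} ≠ -∞`. -/
def digr (A : MPMat n) : SubD n := ⟨Set.univ, fun i j => A i j ≠ ⊥⟩

/-- `W` (a nonempty list of nodes) is a walk in the digraph `G`. -/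
def IsWalkIn (G : SubD n) (W : List (Fin n)) : Prop :=
  W ≠ [] ∧ (∀ v ∈ W, v ∈ G.verts) ∧ W.Chain' G.edge

/-- The length of a walk: its number of edges (number of nodes minus one). -/
def elen (W : List (Fin n)) : ℕ := W.length - 1

/-- The weight `p(W)` of a walk: sum of the weights of its edges. -/
def walkWeight (A : MPMat n) (W : List (Fin n)) : WithBot ℝ :=
  ((W.zip W.tail).map fun p => A p.1 p.2).sum

/-- `W` is a cycle in `G`: a nonempty closed walk with pairwise distinct
nodes (apart from the repeated endpoint). -/
def IsCycleIn (G : SubD n) (W : List (Fin n)) : Prop :=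
  IsWalkIn G W ∧ 2 ≤ W.length ∧ W.head? = W.getLast? ∧ W.dropLast.Nodup

/-- `W` is a path in `G`: a walk with no repeated node. -/
def IsPathIn (G : SubD n) (W : List (Fin n)) : Prop :=
  IsWalkIn G W ∧ W.Nodup

/-- `v` is reachable from `u` by a (possibly empty) walk in `G`. -/
def ReachIn (G : SubD n) (u v : Fin n) : Prop :=
  ∃ W, IsWalkIn G W ∧ W.head? = some u ∧ W.getLast? = some v

/-- `u` and `v` lie in the same strongly connected component of `G`. -/
def SccEq (G : SubD n) (u v : Fin n) : Prop := ReachIn G u v ∧ ReachIn G v u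

/-- The node set of the s.c.c. of `u` in `G`. -/
def sccOf (G : SubD n) (u : Fin n) : Set (Fin n) := {v | SccEq G u v}

/-- The s.c.c. of `u` in `G`, as a digraph. -/
def sccSub (G : SubD n) (u : Fin n) : SubD n :=
  ⟨sccOf G u, fun a b => G.edge a b ∧ a ∈ sccOf G u ∧ b ∈ sccOf G u⟩

/-- `H` is a subgraph of `G`. -/
def SubLE (H G : SubD n) : Prop := H.verts ⊆ G.verts ∧ ∀ u v, H.edge u v → G.edge u v

/-- `G` is completely reducible: there are no edges between distinct s.c.c.'s,
i.e. every edge lies inside an s.c.c. -/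
def CompletelyReducible (G : SubD n) : Prop := ∀ u v, G.edge u v → ReachIn G v u

/-- `G` has no trivial s.c.c.: every node lies on a cycle of `G`. -/
def NoTrivialScc (G : SubD n) : Prop := ∀ v ∈ G.verts, ∃ W, IsCycleIn G W ∧ v ∈ W

/-- `A` is irreducible: `𝒟(A)` is strongly connected. -/
def IrreducibleMat (A : MPMat n) : Prop := ∀ i j : Fin n, ReachIn (digr A) i j

/-- `W` is a closed walk at node `v` in `G`. -/
def IsClosedWalkAt (G : SubD n) (v : Fin n) (W : List (Fin n)) : Prop :=
  IsWalkIn G W ∧ W.head? = some v ∧ W.getLast? = some v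

/-- The greatest common divisor of a set of naturals (0 for the empty set). -/
def setGcd (S : Set ℕ) : ℕ :=
  sInf {d | (∀ s ∈ S, d ∣ s) ∧ ∀ e, (∀ s ∈ S, e ∣ s) → e ∣ d}

/-- The least common multiple of a set of naturals: the least positive common
multiple (0 if there is none). -/
def setLcm (S : Set ℕ) : ℕ := sInf {m | 0 < m ∧ ∀ s ∈ S, s ∣ m}

/-- The cyclicity of the s.c.c. of `v` in `G`: the gcd of the lengths of the
closed walks of `G` through `v` (0 if `v` lies on no nonempty closed walk). -/
def sccCyclicity (G : SubD n) (v : Fin n) : ℕ :=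
  setGcd {l | 0 < l ∧ ∃ W, IsClosedWalkAt G v W ∧ elen W = l}

/-- The cyclicity of a digraph: the lcm of the cyclicities of its
(nontrivial) s.c.c.'s. -/
def graphCyclicity (G : SubD n) : ℕ :=
  setLcm {c | ∃ v ∈ G.verts, c = sccCyclicity G v ∧ 0 < c}

/-- The walk `W` has mean weight `m`, i.e. `p(W) = l(W)·m` (finitely). -/
def meanIs (A : MPMat n) (W : List (Fin n)) (m : ℝ) : Prop :=
  walkWeight A W = (((elen W : ℝ) * m : ℝ) : WithBot ℝ)

/-- `lam` is the maximum cycle mean `λ(A)` of `A`: it is the mean of some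
cycle of `𝒟(A)` and no cycle has a larger mean.  (Its existence is
equivalent to `𝒟(A)` containing a cycle, i.e. `λ(A) ≠ -∞`.) -/
def IsMaxCycleMean (A : MPMat n) (lam : ℝ) : Prop :=
  (∃ W, IsCycleIn (digr A) W ∧ meanIs A W lam) ∧
  ∀ W m, IsCycleIn (digr A) W → meanIs A W m → m ≤ lam

/-- The set of critical nodes: nodes on some cycle of mean `λ(A)`. -/
def critNodes (A : MPMat n) (lam : ℝ) : Set (Fin n) :=
  {v | ∃ W, IsCycleIn (digr A) W ∧ meanIs A W lam ∧ v ∈ W}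

/-- Critical edges: edges of some cycle of mean `λ(A)`. -/
def critEdges (A : MPMat n) (lam : ℝ) (u v : Fin n) : Prop :=
  ∃ W, IsCycleIn (digr A) W ∧ meanIs A W lam ∧ (u, v) ∈ W.zip W.tail

/-- The critical graph `𝒞(A)`. -/
def critSub (A : MPMat n) (lam : ℝ) : SubD n := ⟨critNodes A lam, critEdges A lam⟩

/-- Add the real constant `c` to every entry. -/
def shiftMat (A : MPMat n) (c : ℝ) : MPMat n := fun i j => A i j + (c : WithBot ℝ)

/-- The max-plus Kleene star `X^* = I ⊕ X ⊕ X² ⊕ ⋯` (entrywise supremum). -/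
def mpStar (X : MPMat n) : MPMat n := fun i j => ⨆ t : ℕ, mpPow X t i j

/-- The matrix `M = (((-λ)⊗A)^{γ(𝒢)})^*` used to define the CSR terms. -/
def csrM (A : MPMat n) (lam : ℝ) (G : SubD n) : MPMat n :=
  mpStar (mpPow (shiftMat A (-lam)) (graphCyclicity G))

/-- The `C` term of the CSR expansion of `A` w.r.t. the subgraph `G`. -/
def csrC (A : MPMat n) (lam : ℝ) (G : SubD n) : MPMat n :=
  fun i j => if j ∈ G.verts then csrM A lam G i j else ⊥

/-- The `R` term of the CSR expansion of `A` w.r.t. the subgraph `G`. -/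
def csrR (A : MPMat n) (lam : ℝ) (G : SubD n) : MPMat n :=
  fun i j => if i ∈ G.verts then csrM A lam G i j else ⊥

/-- The `S` term of the CSR expansion of `A` w.r.t. the subgraph `G`. -/
def csrS (A : MPMat n) (lam : ℝ) (G : SubD n) : MPMat n :=
  fun i j => if G.edge i j then A i j + ((-lam : ℝ) : WithBot ℝ) else ⊥

/-- The matrix `C S^t R`. -/
def csr (A : MPMat n) (lam : ℝ) (G : SubD n) (t : ℕ) : MPMat n :=
  mpMul (mpMul (csrC A lam G) (mpPow (csrS A lam G) t)) (csrR A lam G)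

/-- `G` is a representing subgraph of the critical graph `crit`: a completely
reducible subgraph (with no trivial s.c.c.) such that every s.c.c. of `crit`
contains exactly one s.c.c. of `G`. -/
structure IsRepresenting (crit G : SubD n) : Prop where
  le : SubLE G crit
  compRed : CompletelyReducible G
  noTriv : NoTrivialScc G
  covers : ∀ u ∈ crit.verts, ∃ v ∈ G.verts, SccEq crit u v
  unique : ∀ v ∈ G.verts, ∀ w ∈ G.verts, SccEq crit v w → SccEq G v w

/-- `B` is subordinate to `A`: obtained from `A` by setting some entries to `-∞`. -/
def Subordinate (B A : MPMat n) : Prop := ∀ i j, B i j = A i j ∨ B i j = ⊥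

/-- Set to `-∞` all entries in the rows and columns indexed by `S`. -/
def zeroRC (A : MPMat n) (S : Set (Fin n)) : MPMat n :=
  fun i j => if i ∈ S ∨ j ∈ S then ⊥ else A i j

/-- The Nachtigall scheme: zero out the rows and columns of critical nodes. -/
def bN (A : MPMat n) (lam : ℝ) : MPMat n := zeroRC A (critNodes A lam)

/-- `V` is a max-balancing of `A`: `V = D⁻¹((-λ(A))⊗A)D` with all entries `≤ 0`,
entries `0` on critical edges, and every edge of `𝒟(V)` lies on a cycle all of
whose edges have weight at least that of the given edge (cycle cover). -/
def IsMaxBalancing (A : MPMat n) (lam : ℝ) (V : MPMat n) : Prop :=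
  (∃ d : Fin n → ℝ, ∀ i j, V i j = A i j + ((d j - d i - lam : ℝ) : WithBot ℝ)) ∧
  (∀ i j, V i j ≤ (0 : WithBot ℝ)) ∧
  (∀ i j, critEdges A lam i j → V i j = (0 : WithBot ℝ)) ∧
  (∀ i j, V i j ≠ ⊥ →
    ∃ W, IsCycleIn (digr V) W ∧ (i, j) ∈ W.zip W.tail ∧ ∀ p ∈ W.zip W.tail, V i j ≤ V p.1 p.2)

/-- The Hartmann-Arguelles threshold graph `Θ^{ha}(μ)`: induced by the edges
with `v_{ij} ≥ μ`; by convention `Θ^{ha}(-∞) = 𝒟(A)`. -/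
def thrHA (A V : MPMat n) (μ : WithBot ℝ) : SubD n :=
  if μ = ⊥ then digr A
  else ⟨{u | ∃ w, μ ≤ V u w ∨ μ ≤ V w u}, fun u v => μ ≤ V u v⟩

/-- The cycle threshold graph `Θ^{ct}(μ)`: induced by all nodes and edges of
cycles of mean weight `≥ μ`; by convention `Θ^{ct}(-∞) = 𝒟(A)`. -/
def thrCT (A : MPMat n) (μ : WithBot ℝ) : SubD n :=
  if μ = ⊥ then digr A
  else ⟨{v | ∃ W m, IsCycleIn (digr A) W ∧ meanIs A W m ∧ μ ≤ (m : WithBot ℝ) ∧ v ∈ W},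
        fun u v => ∃ W m, IsCycleIn (digr A) W ∧ meanIs A W m ∧ μ ≤ (m : WithBot ℝ) ∧
          (u, v) ∈ W.zip W.tail⟩

/-- `Θ` has an s.c.c. containing no s.c.c. of `crit`. -/
def HasFreeScc (Θ crit : SubD n) : Prop :=
  ∃ u ∈ Θ.verts, ¬ ∃ w ∈ crit.verts, sccOf crit w ⊆ sccOf Θ u

/-- `μ` is the greatest value `≤ λ(A)` satisfying `P` (or `-∞` if there is
no such value). -/
def IsThrMax (P : WithBot ℝ → Prop) (lam : ℝ) (μ : WithBot ℝ) : Prop :=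
  (μ ≤ (lam : WithBot ℝ) ∧ P μ ∧ ∀ μ', μ' ≤ (lam : WithBot ℝ) → P μ' → μ' ≤ μ) ∨
  (μ = ⊥ ∧ ∀ μ', μ' ≤ (lam : WithBot ℝ) → ¬ P μ')

/-- `μ = μ^{ha}` for the max-balancing `V` of `A`. -/
def IsMuHA (A : MPMat n) (lam : ℝ) (V : MPMat n) (μ : WithBot ℝ) : Prop :=
  IsThrMax (fun m => HasFreeScc (thrHA A V m) (critSub A lam)) lam μ

/-- `μ = μ^{ct}` for `A`. -/
def IsMuCT (A : MPMat n) (lam : ℝ) (μ : WithBot ℝ) : Prop :=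
  IsThrMax (fun m => HasFreeScc (thrCT A m) (critSub A lam)) lam μ

/-- The union of the s.c.c.'s of `Θ` intersecting the node set `crit`. -/
def unionSccMeeting (Θ : SubD n) (crit : Set (Fin n)) : Set (Fin n) :=
  {v | v ∈ Θ.verts ∧ ∃ w ∈ crit, SccEq Θ v w}

/-- The node set `𝒢^{ha}` of the Hartmann-Arguelles scheme. -/
def haNodes (A V : MPMat n) (lam : ℝ) (μ : WithBot ℝ) : Set (Fin n) :=
  unionSccMeeting (thrHA A V μ) (critNodes A lam)

/-- The matrix `B^{HA}` of the Hartmann-Arguelles scheme. -/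
def bHA (A V : MPMat n) (lam : ℝ) (μ : WithBot ℝ) : MPMat n :=
  zeroRC A (haNodes A V lam μ)

/-- The node set `𝒢^{ct}` of the cycle threshold scheme. -/
def ctNodes (A : MPMat n) (lam : ℝ) (μ : WithBot ℝ) : Set (Fin n) :=
  unionSccMeeting (thrCT A μ) (critNodes A lam)

/-- The matrix `B^{ct}` of the cycle threshold scheme. -/
def bCT (A : MPMat n) (lam : ℝ) (μ : WithBot ℝ) : MPMat n :=
  zeroRC A (ctNodes A lam μ)

/-- The graph `𝒢^{ct}`: the union of the s.c.c.'s of `Θ^{ct}(μ^{ct})`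
intersecting `𝒞(A)`, as a digraph. -/
def ctSub (A : MPMat n) (lam : ℝ) (μ : WithBot ℝ) : SubD n :=
  ⟨ctNodes A lam μ,
   fun u v => (thrCT A μ).edge u v ∧ u ∈ ctNodes A lam μ ∧ v ∈ ctNodes A lam μ⟩

/-- The circumference of `G`: the greatest length of a cycle of `G`. -/
def circumf (G : SubD n) : ℕ := sSup {l | ∃ W, IsCycleIn G W ∧ W.length = l + 1}

/-- The cab driver's diameter of `G`: the greatest length of a path of `G`. -/
def cabDiam (G : SubD n) : ℕ := sSup {l | ∃ W, IsPathIn G W ∧ W.length = l + 1}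

/-- The girth of the s.c.c. of `v` in `G`: the least length of a cycle lying
in the s.c.c. of `v`. -/
def sccGirth (G : SubD n) (v : Fin n) : ℕ :=
  sInf {l | 0 < l ∧ ∃ W, IsCycleIn G W ∧ W.length = l + 1 ∧ ∀ u ∈ W, SccEq G v u}

/-- The max-girth of `G`: the greatest girth of an s.c.c. of `G`. -/
def maxGirth (G : SubD n) : ℕ := sSup {g | ∃ v ∈ G.verts, 0 < g ∧ g = sccGirth G v}

/-- The max-cyclicity of `G`: the greatest cyclicity of an s.c.c. of `G`. -/
def maxCyclicity (G : SubD n) : ℕ := sSup {c | ∃ v ∈ G.verts, 0 < c ∧ c = sccCyclicity G v}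

/-- The Wielandt number: `Wi(n) = (n-1)² + 1` for `n > 1`, `Wi(1) = 0`. -/
def wielandt (k : ℕ) : ℕ := if k ≤ 1 then 0 else (k - 1) ^ 2 + 1

/-- The set of finite entries of `A`. -/
def finEntries (A : MPMat n) : Set ℝ := {x | ∃ i j, A i j = (x : WithBot ℝ)}

/-- The least finite entry of `A`. -/
def minEnt (A : MPMat n) : ℝ := sInf (finEntries A)

/-- The greatest finite entry of `A`. -/
def maxEnt (A : MPMat n) : ℝ := sSup (finEntries A)

/-- `‖A‖`: the difference between the greatest and least finite entries. -/
def matNorm (A : MPMat n) : ℝ := maxEnt A - minEnt A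

/-- `n_B`: the size of the smallest square submatrix of `B` containing all
finite entries of `B`. -/
def nB (B : MPMat n) : ℕ := Set.ncard {i | ∃ j, B i j ≠ ⊥ ∨ B j i ≠ ⊥}

/-- `‖v‖`: the difference between the greatest and least entries of `v`. -/
def vecNorm (v : Fin n → ℝ) : ℝ := sSup (Set.range v) - sInf (Set.range v)

/-- The exploration penalty `ep^γ(i)` (w.r.t. the graph `crit`): the least `T`
such that for every multiple `t` of `γ` with `t ≥ T` there is a closed walk of
length `t` at `i` in `crit`. -/
def epAt (crit : SubD n) (γ : ℕ) (i : Fin n) : ℕ :=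
  sInf {T | ∀ t, γ ∣ t → T ≤ t → ∃ W, IsClosedWalkAt crit i W ∧ elen W = t}

/-- The exploration penalty `ep^γ(S)`: the maximum of `ep^γ(i)` over `i ∈ S`. -/
def epOn (crit : SubD n) (γ : ℕ) (S : Set (Fin n)) : ℕ := sSup {e | ∃ i ∈ S, e = epAt crit γ i}

/-- `ep(𝒞(A))`: the maximum over the s.c.c.'s `𝒞_l` of `crit` of
`ep^{γ(𝒞_l)}(𝒞_l)`. -/
def epCrit (crit : SubD n) : ℕ :=
  sSup {e | ∃ i ∈ crit.verts, e = epAt crit (sccCyclicity crit i) i}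

/-- The weak CSR expansion `A^t = λ^{⊗t}⊗(CS^tR) ⊕ B^t` holds at time `t`
(with CSR terms taken w.r.t. the subgraph `G`). -/
def weakCSReq (A B : MPMat n) (lam : ℝ) (G : SubD n) (t : ℕ) : Prop :=
  ∀ i j, mpPow A t i j = max (csr A lam G t i j + (((t : ℝ) * lam : ℝ) : WithBot ℝ)) (mpPow B t i j)

/-- The domination `λ^{⊗t}⊗(CS^tR) ≥ B^t` holds at time `t`. -/
def T2eq (A B : MPMat n) (lam : ℝ) (G : SubD n) (t : ℕ) : Prop :=
  ∀ i j, mpPow B t i j ≤ csr A lam G t i j + (((t : ℝ) * lam : ℝ) : WithBot ℝ)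

/-- The domination `λ^{⊗t}⊗(CS^tRv) ≥ B^t v` holds at time `t`. -/
def T2veq (A B : MPMat n) (lam : ℝ) (G : SubD n) (v : Fin n → ℝ) (t : ℕ) : Prop :=
  ∀ i, mpMulVec (mpPow B t) (fun j => (v j : WithBot ℝ)) i
      ≤ mpMulVec (csr A lam G t) (fun j => (v j : WithBot ℝ)) i + (((t : ℝ) * lam : ℝ) : WithBot ℝ)

/-- One step of removing a (nonempty) closed subwalk from a walk. -/
def RemoveStep (W V : List (Fin n)) : Prop :=
  ∃ (pre mid post : List (Fin n)) (x : Fin n),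
    W = pre ++ x :: mid ++ x :: post ∧ V = pre ++ x :: post

/-- One step of inserting a cycle of `C` into a walk (at an occurrence of a
node of that cycle). -/
def InsertStep (C : SubD n) (W V : List (Fin n)) : Prop :=
  ∃ (pre post mid : List (Fin n)) (x : Fin n),
    W = pre ++ x :: post ∧ V = pre ++ x :: mid ++ x :: post ∧ IsCycleIn C (x :: mid ++ [x])

/-- `V` is obtained from `W` by removing cycles. -/
def RemOnly : List (Fin n) → List (Fin n) → Prop := Relation.ReflTransGen RemoveStep

/-- `V` is obtained from `W` by removing cycles and possibly inserting cycles
of `C`. -/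
def RemIns (C : SubD n) : List (Fin n) → List (Fin n) → Prop :=
  Relation.ReflTransGen fun W V => RemoveStep W V ∨ InsertStep C W V

/-- `V` is obtained from `W` by removing at least one cycle and possibly
inserting cycles of `C`. -/
def RemInsStrict (C : SubD n) (W V : List (Fin n)) : Prop :=
  ∃ W₁ W₂, RemIns C W W₁ ∧ RemoveStep W₁ W₂ ∧ RemIns C W₂ V

/-- `T` witnesses the cycle removal threshold `T_cr^γ(C) ≤ T` in the digraph
`G`: every walk of `G` through `C` of length `≥ T` can be reduced (removing
cycles, possibly inserting cycles of `C`) to a walk through `C` with the same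
endpoints, the same length mod `γ`, and length `≤ T`. -/
def TcrProp (G C : SubD n) (γ T : ℕ) : Prop :=
  ∀ W, IsWalkIn G W → (∃ v ∈ C.verts, v ∈ W) → T ≤ elen W →
    ∃ V, RemIns C W V ∧ IsWalkIn G V ∧ (∃ v ∈ C.verts, v ∈ V) ∧
      V.head? = W.head? ∧ V.getLast? = W.getLast? ∧ elen V ≡ elen W [MOD γ] ∧ elen V ≤ T

/-- `T` witnesses the strict cycle removal threshold `T̃_cr^γ(C) ≤ T`. -/
def TcrStrictProp (G C : SubD n) (γ T : ℕ) : Prop :=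
  ∀ W, IsWalkIn G W → (∃ v ∈ C.verts, v ∈ W) → T ≤ elen W →
    ∃ V, RemInsStrict C W V ∧ IsWalkIn G V ∧ (∃ v ∈ C.verts, v ∈ V) ∧
      V.head? = W.head? ∧ V.getLast? = W.getLast? ∧ elen V ≡ elen W [MOD γ] ∧ elen V ≤ T

/-- The cycle removal threshold `T_cr^γ(C)` of the subgraph `C` in `G`. -/
def Tcr (G C : SubD n) (γ : ℕ) : ℕ := sInf {T | TcrProp G C γ T}

/-- The strict cycle removal threshold `T̃_cr^γ(C)` of the subgraph `C` in `G`. -/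
def TcrStrict (G C : SubD n) (γ : ℕ) : ℕ := sInf {T | TcrStrictProp G C γ T}

/-- The subgraph formed by the nodes and edges of the walk `W`. -/
def cycleSub (W : List (Fin n)) : SubD n :=
  ⟨{v | v ∈ W}, fun a b => (a, b) ∈ W.zip W.tail⟩

/-- The single-node subgraph `{i}` (with no edges). -/
def singleSub (i : Fin n) : SubD n := ⟨{i}, fun _ _ => False⟩

/-- `λ(M)` as an element of `ℝmax` (`-∞` if `𝒟(M)` has no cycle). -/
def lamW (M : MPMat n) : WithBot ℝ :=
  sSup {x : WithBot ℝ | ∃ W m, IsCycleIn (digr M) W ∧ meanIs M W m ∧ x = (m : WithBot ℝ)}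

end MaxPlus

namespace MaxPlus

section Helpers

variable {n : ℕ}

theorem ww_single (A : MPMat n) (a : Fin n) : walkWeight A [a] = 0 := by
  simp [walkWeight]

theorem ww_cons (A : MPMat n) (a b : Fin n) (l : List (Fin n)) :
    walkWeight A (a :: b :: l) = A a b + walkWeight A (b :: l) := by
  simp [walkWeight]

theorem ww_append (A : MPMat n) (u : Fin n) (Q : List (Fin n)) : ∀ P : List (Fin n),
    walkWeight A (P ++ u :: Q) = walkWeight A (P ++ [u]) + walkWeight A (u :: Q)
  | [] => by simp [ww_single]
  | [a] => by simp [ww_single, ww_cons]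
  | a :: b :: P => by
    have := ww_append A u Q (b :: P)
    simp only [List.cons_append] at this ⊢
    rw [ww_cons, ww_cons, this, add_assoc]

theorem zip_split (u v : Fin n) : ∀ W : List (Fin n), (u, v) ∈ W.zip W.tail →
    ∃ P Q, W = P ++ u :: v :: Q
  | [], h => by simp at h
  | [a], h => by simp at h
  | a :: b :: l, h => by
    simp only [List.tail_cons, List.zip_cons_cons, List.mem_cons, Prod.mk.injEq] at h
    rcases h with ⟨rfl, rfl⟩ | h
    · exact ⟨[], l, rfl⟩
    · obtain ⟨P, Q, hPQ⟩ := zip_split u v (b :: l) (by simpa using h)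
      exact ⟨a :: P, Q, by simp [hPQ]⟩

theorem zip_mem (u v : Fin n) (P Q : List (Fin n)) :
    (u, v) ∈ (P ++ u :: v :: Q).zip (P ++ u :: v :: Q).tail := by
  induction P with
  | nil => simp
  | cons a P ih =>
    cases P with
    | nil => simp
    | cons b P => simp only [List.cons_append, List.tail_cons, List.zip_cons_cons,
                    List.mem_cons] at ih ⊢; exact Or.inr ih

theorem chain_zip {R : Fin n → Fin n → Prop} {W : List (Fin n)} (h : W.IsChain R)
    {u v : Fin n} (hm : (u, v) ∈ W.zip W.tail) : R u v := by
  obtain ⟨P, Q, rfl⟩ := zip_split u v W hm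
  have := (List.isChain_append.1 h).2.1
  exact (List.isChain_cons_cons.1 this).1

/-- weighted walks -/
inductive WW (M : MPMat n) : ℕ → Fin n → Fin n → ℝ → Prop
  | nil (i : Fin n) : WW M 0 i i 0
  | cons {s : ℕ} {i j k : Fin n} {w x : ℝ} (h : M i j = (w : WithBot ℝ)) (t : WW M s j k x) :
      WW M (s + 1) i k (w + x)

theorem WW.append {M : MPMat n} {s s' : ℕ} {i j k : Fin n} {x y : ℝ} (h : WW M s i j x)
    (h' : WW M s' j k y) : WW M (s + s') i k (x + y) := by
  induction h with
  | nil i => simpa using h'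
  | @cons s i j _ w x h t ih =>
    have := WW.cons h (ih h')
    rwa [show s + 1 + s' = s + s' + 1 by ring, show w + x + y = w + (x + y) by ring]

theorem WW.mono {M M' : MPMat n} (hM : ∀ i j (w : ℝ), M i j = w → M' i j = w) {s : ℕ}
    {i j : Fin n} {x : ℝ} (h : WW M s i j x) : WW M' s i j x := by
  induction h with
  | nil i => exact .nil i
  | cons h t ih => exact .cons (hM _ _ _ h) ih

theorem WW.split {M : MPMat n} {b : ℕ} {j : Fin n} : ∀ {a : ℕ} {i : Fin n} {x : ℝ},
    WW M (a + b) i j x → ∃ k y z, WW M a i k y ∧ WW M b k j z ∧ x = y + z := by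
  intro a
  induction a with
  | zero => intro i x h; exact ⟨i, 0, x, .nil i, by simpa using h, by simp⟩
  | succ a ih =>
    intro i x h
    rw [show a + 1 + b = (a + b) + 1 by ring] at h
    cases h with
    | cons h t =>
      obtain ⟨k, y, z, h1, h2, h3⟩ := ih t
      exact ⟨k, _, z, .cons h h1, h2, by rw [h3]; ring⟩

theorem WW.rep {M : MPMat n} {s : ℕ} {i : Fin n} (h : WW M s i i 0) (m : ℕ) :
    WW M (s * m) i i 0 := by
  induction m with
  | zero => exact .nil i
  | succ m ih => simpa [Nat.mul_succ] using ih.append h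

theorem WW.le_pow {M : MPMat n} {s : ℕ} {i j : Fin n} {x : ℝ} (h : WW M s i j x) :
    (x : WithBot ℝ) ≤ mpPow M s i j := by
  induction h with
  | nil i => simp [mpPow]
  | @cons s i j k w x h t ih =>
    refine le_trans ?_ (Finset.le_sup (f := fun k' => M i k' + mpPow M s k' k) (Finset.mem_univ j))
    simp only [h, WithBot.coe_add]
    gcongr

theorem sup_eq_coe {f : Fin n → WithBot ℝ} {x : ℝ} (h : Finset.univ.sup f = x) :
    ∃ k, f k = x := by
  rcases (Finset.univ : Finset (Fin n)).eq_empty_or_nonempty with he | hne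
  · rw [he] at h; simp at h
  · obtain ⟨k, -, hk⟩ := Finset.exists_mem_eq_sup _ hne f
    exact ⟨k, hk ▸ h⟩

theorem add_eq_coe' {a b : WithBot ℝ} {x : ℝ} (h : a + b = x) :
    ∃ y z : ℝ, a = y ∧ b = z ∧ x = y + z := by
  induction a with
  | bot => simp at h
  | coe a =>
    induction b with
    | bot => simp at h
    | coe b => exact ⟨a, b, rfl, rfl, by exact_mod_cast h.symm⟩

theorem WW.of_pow {M : MPMat n} {s : ℕ} : ∀ {i j : Fin n} {x : ℝ},
    mpPow M s i j = x → WW M s i j x := by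
  induction s with
  | zero =>
    intro i j x h
    simp only [mpPow] at h
    split_ifs at h with hij
    · subst hij
      have : x = 0 := by exact_mod_cast h.symm
      subst this; exact .nil i
    · simp at h
  | succ s ih =>
    intro i j x h
    obtain ⟨k, hk⟩ := sup_eq_coe (f := fun k => M i k + mpPow M s k j) h
    obtain ⟨y, z, h1, h2, rfl⟩ := add_eq_coe' hk
    exact .cons h1 (ih h2)

theorem pow_pow (M : MPMat n) (g a : ℕ) : mpPow (mpPow M g) a = mpPow M (g * a) := by
  have key : ∀ a i j (x : ℝ), WW (mpPow M g) a i j x → WW M (g * a) i j x := by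
    intro a i j x h
    induction h with
    | nil i => exact .nil i
    | @cons s i j k w x h t ih =>
      have := (WW.of_pow h).append ih
      rwa [show g * (s + 1) = g + g * s by ring]
  have key2 : ∀ a i j (x : ℝ), WW M (g * a) i j x → (x : WithBot ℝ) ≤ mpPow (mpPow M g) a i j := by
    intro a
    induction a with
    | zero => intro i j x h; exact h.le_pow
    | succ a ih =>
      intro i j x h
      rw [show g * (a + 1) = g + g * a by ring] at h
      obtain ⟨k, y, z, h1, h2, rfl⟩ := h.split
      refine le_trans ?_ (Finset.le_sup (f := fun k' => mpPow M g i k' + mpPow (mpPow M g) a k' j)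
        (Finset.mem_univ k))
      rw [WithBot.coe_add]
      exact add_le_add h1.le_pow (ih _ _ _ h2)
  funext i j
  apply le_antisymm
  · cases h : mpPow (mpPow M g) a i j with
    | bot => exact bot_le
    | coe x => exact (key _ _ _ _ (.of_pow h)).le_pow
  · cases h : mpPow M (g * a) i j with
    | bot => exact bot_le
    | coe x => exact key2 _ _ _ _ (.of_pow h)

theorem WW.of_list {M B : MPMat n} : ∀ (L : List (Fin n)) (a : Fin n) (x : ℝ),
    (∀ u v, (u, v) ∈ (a :: L).zip L → M u v = B u v) → walkWeight B (a :: L) = x →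
    ∃ b, (a :: L).getLast? = some b ∧ WW M L.length a b x
  | [], a, x, _, h => by
    rw [ww_single] at h
    have : x = 0 := by exact_mod_cast h.symm
    subst this
    exact ⟨a, rfl, .nil a⟩
  | b :: L, a, x, hm, h => by
    rw [ww_cons] at h
    obtain ⟨y, z, h1, h2, rfl⟩ := add_eq_coe' h
    obtain ⟨c, hc, hW⟩ := WW.of_list (M := M) L b z
      (fun u v huv => hm u v (by simp [huv])) h2
    exact ⟨c, by simpa using hc, .cons (by rw [hm a b (by simp), h1]) hW⟩

theorem ww_ne_bot {M : MPMat n} : ∀ (W : List (Fin n)),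
    (∀ u v, (u, v) ∈ W.zip W.tail → M u v ≠ ⊥) → ∃ x : ℝ, walkWeight M W = x
  | [], _ => ⟨0, by simp [walkWeight]⟩
  | [a], _ => ⟨0, by simp [walkWeight]⟩
  | a :: b :: L, h => by
    obtain ⟨x, hx⟩ := ww_ne_bot (M := M) (b :: L) (fun u v huv => h u v (by
      simp only [List.tail_cons, List.zip_cons_cons, List.mem_cons] at huv ⊢; exact Or.inr huv))
    obtain ⟨w, hw⟩ := WithBot.ne_bot_iff_exists.1 (h a b (by simp))
    exact ⟨w + x, by rw [ww_cons, hx, ← hw, WithBot.coe_add]⟩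

theorem ww_shift (A : MPMat n) (c : ℝ) : ∀ (W : List (Fin n)),
    walkWeight (shiftMat A c) W = walkWeight A W + (((elen W : ℝ) * c : ℝ) : WithBot ℝ)
  | [] => by simp [walkWeight, elen]
  | [a] => by simp [walkWeight, elen]
  | a :: b :: L => by
    rw [ww_cons, ww_cons, ww_shift A c (b :: L)]
    have : ((elen (a :: b :: L) : ℝ) * c) = c + (elen (b :: L) : ℝ) * c := by
      simp [elen]; ring
    rw [this, WithBot.coe_add, shiftMat]
    abel

theorem shift_ne_bot (A : MPMat n) (c : ℝ) (i j : Fin n) :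
    shiftMat A c i j ≠ ⊥ ↔ A i j ≠ ⊥ := by
  simp [shiftMat]

theorem cycle_le {A : MPMat n} {lam : ℝ} (hlam : IsMaxCycleMean A lam) {W : List (Fin n)}
    (hW : IsCycleIn (digr A) W) : walkWeight (shiftMat A (-lam)) W ≤ 0 := by
  rw [ww_shift]
  cases h : walkWeight A W with
  | bot => simp
  | coe r =>
    have hpos : (0 : ℝ) < elen W := by
      have := hW.2.1
      have : 0 < elen W := by unfold elen; omega
      exact_mod_cast this
    have := hlam.2 W (r / elen W) hW (by rw [meanIs, h]; congr 1; field_simp)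
    rw [div_le_iff₀ hpos] at this
    rw [← WithBot.coe_add, ← WithBot.coe_zero, WithBot.coe_le_coe]
    nlinarith

theorem erase {A : MPMat n} {lam : ℝ} (hlam : IsMaxCycleMean A lam) {s : ℕ} {i j : Fin n}
    {x : ℝ} (h : WW (shiftMat A (-lam)) s i j x) :
    ∃ P : List (Fin n), (i :: P).Nodup ∧ (i :: P).IsChain (fun a b => A a b ≠ ⊥) ∧
      (i :: P).getLast? = some j ∧ (x : WithBot ℝ) ≤ walkWeight (shiftMat A (-lam)) (i :: P) := by
  induction h with
  | nil i => exact ⟨[], by simp, by simp, by simp, by simp [ww_single]⟩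
  | @cons s i j k w x h t ih =>
    obtain ⟨P, hnd, hch, hl, hx⟩ := ih
    have hij : A i j ≠ ⊥ := (shift_ne_bot A (-lam) i j).1 (by rw [h]; simp)
    have hch' : (i :: j :: P).IsChain (fun a b => A a b ≠ ⊥) := List.isChain_cons_cons.2 ⟨hij, hch⟩
    have hx' : ((w + x : ℝ) : WithBot ℝ) ≤ walkWeight (shiftMat A (-lam)) (i :: j :: P) := by
      rw [ww_cons, h, WithBot.coe_add]; gcongr
    by_cases hi : i ∈ j :: P
    · obtain ⟨P1, P2, hP⟩ := List.append_of_mem hi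
      rw [hP] at hnd hch' hl hx'
      refine ⟨P2, (List.nodup_append.1 hnd).2.1, ?_, ?_, ?_⟩
      · rw [← List.cons_append] at hch'
        exact (List.isChain_append.1 hch').2.1
      · simpa [List.getLast?_append] using hl
      · rw [← List.cons_append, ww_append] at hx'
        have hcyc : IsCycleIn (digr A) (i :: P1 ++ [i]) := by
          refine ⟨⟨by simp, by simp [digr], ?_⟩, by simp, ?_, ?_⟩
          · rw [show i :: (P1 ++ i :: P2) = (i :: P1 ++ [i]) ++ P2 by simp] at hch'
            exact (List.isChain_append.1 hch').1
          · rw [List.getLast?_append]; simp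
          · rw [List.dropLast_concat]
            have h2 := List.nodup_append.1 hnd
            refine List.nodup_cons.2 ⟨fun hm => h2.2.2 i hm i (by simp) rfl, h2.1⟩
        have := cycle_le hlam hcyc
        calc _ ≤ _ := hx'
          _ ≤ 0 + walkWeight (shiftMat A (-lam)) (i :: P2) := by gcongr
          _ = _ := zero_add _
    · exact ⟨j :: P, List.nodup_cons.2 ⟨hi, hnd⟩, hch', by simpa using hl, hx'⟩

theorem closed_le {A : MPMat n} {lam : ℝ} (hlam : IsMaxCycleMean A lam) {s : ℕ} {i : Fin n}
    {x : ℝ} (h : WW (shiftMat A (-lam)) s i i x) : x ≤ 0 := by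
  obtain ⟨P, hnd, -, hl, hx⟩ := erase hlam h
  have : P = [] := by
    cases P with
    | nil => rfl
    | cons b P =>
      exfalso
      rw [List.getLast?_cons_cons] at hl
      exact (List.nodup_cons.1 hnd).1 (List.mem_of_getLast? hl)
  subst this
  rw [ww_single] at hx
  exact_mod_cast hx

theorem pow_bdd {A : MPMat n} {lam : ℝ} (hlam : IsMaxCycleMean A lam) (i j : Fin n) :
    ∃ b : WithBot ℝ, ∀ s, mpPow (shiftMat A (-lam)) s i j ≤ b := by
  refine ⟨(Finset.univ : Finset {l : List (Fin n) // l.Nodup}).sup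
    (fun l => walkWeight (shiftMat A (-lam)) l.1), fun s => ?_⟩
  cases h : mpPow (shiftMat A (-lam)) s i j with
  | bot => exact bot_le
  | coe x =>
    obtain ⟨P, hnd, -, -, hx⟩ := erase hlam (.of_pow h)
    exact hx.trans (Finset.le_sup (f := fun l : {l : List (Fin n) // l.Nodup} =>
      walkWeight (shiftMat A (-lam)) l.1) (Finset.mem_univ ⟨_, hnd⟩))

theorem le_csrM {A : MPMat n} {lam : ℝ} (hlam : IsMaxCycleMean A lam) (G : SubD n)
    {i j : Fin n} {a : ℕ} {x : ℝ} (h : WW (shiftMat A (-lam)) (graphCyclicity G * a) i j x) :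
    (x : WithBot ℝ) ≤ csrM A lam G i j := by
  obtain ⟨b, hb⟩ := pow_bdd hlam i j
  refine h.le_pow.trans ?_
  rw [← pow_pow]
  refine le_ciSup (f := fun t => mpPow (mpPow (shiftMat A (-lam)) (graphCyclicity G)) t i j) ?_ a
  refine ⟨b, ?_⟩
  rintro _ ⟨t, rfl⟩
  simp only [pow_pow]
  exact hb _

theorem csrM_add_le {A : MPMat n} {lam : ℝ} (G : SubD n) {i j : Fin n} {y X : WithBot ℝ}
    (h : ∀ a (x : ℝ), WW (shiftMat A (-lam)) (graphCyclicity G * a) i j x → (x : WithBot ℝ) + y ≤ X) :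
    csrM A lam G i j + y ≤ X := by
  cases y with
  | bot => simp
  | coe y =>
    have hX : csrM A lam G i j ≤ X + ((-y : ℝ) : WithBot ℝ) := by
      refine ciSup_le (f := fun t => mpPow (mpPow (shiftMat A (-lam)) (graphCyclicity G)) t i j)
        fun t => ?_
      rw [pow_pow]
      cases hp : mpPow (shiftMat A (-lam)) (graphCyclicity G * t) i j with
      | bot => exact bot_le
      | coe x =>
        have := h t x (.of_pow hp)
        calc (x : WithBot ℝ) = (x + y) + ((-y : ℝ) : WithBot ℝ) := by
              norm_cast; simp
          _ ≤ _ := by gcongr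
    calc _ ≤ X + ((-y : ℝ) : WithBot ℝ) + y := by gcongr
      _ = X := by rw [add_assoc, ← WithBot.coe_add]; simp

/-- crit matrix -/
def critK (A : MPMat n) (lam : ℝ) : MPMat n := csrS A lam (critSub A lam)

theorem csrS_coe {A : MPMat n} {lam : ℝ} {G : SubD n} {i j : Fin n} {w : ℝ}
    (h : csrS A lam G i j = w) : G.edge i j ∧ shiftMat A (-lam) i j = w := by
  unfold csrS at h
  split_ifs at h with hE
  · exact ⟨hE, h⟩
  · simp at h

theorem csrS_edge {A : MPMat n} {lam : ℝ} {G : SubD n} {i j : Fin n} (h : G.edge i j) :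
    csrS A lam G i j = shiftMat A (-lam) i j := by
  simp [csrS, h, shiftMat]

theorem crit_ne_bot {A : MPMat n} {lam : ℝ} {i j : Fin n} (h : critEdges A lam i j) :
    A i j ≠ ⊥ := by
  obtain ⟨W, hW, -, hm⟩ := h
  exact chain_zip (R := (digr A).edge) hW.1.2.2 hm

theorem WW.toB {A : MPMat n} {lam : ℝ} {G : SubD n} {s : ℕ} {i j : Fin n} {x : ℝ}
    (h : WW (csrS A lam G) s i j x) : WW (shiftMat A (-lam)) s i j x :=
  h.mono fun _ _ _ h => (csrS_coe h).2

theorem WW.toK {A : MPMat n} {lam : ℝ} {G : SubD n} (hG : SubLE G (critSub A lam)) {s : ℕ}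
    {i j : Fin n} {x : ℝ}
    (h : WW (csrS A lam G) s i j x) : WW (critK A lam) s i j x :=
  h.mono fun i j w h => by
    rw [critK, csrS_edge (hG.2 _ _ (csrS_coe h).1)]; exact (csrS_coe h).2

/-- rotating a closed list through a split -/
theorem rotate {M B : MPMat n} {W P Q : List (Fin n)} {u v : Fin n}
    (hW : W = P ++ u :: v :: Q) (hhl : W.head? = W.getLast?)
    (hM : ∀ a b, (a, b) ∈ W.zip W.tail → M a b = B a b) {r : ℝ} (hr : walkWeight B W = r) :
    ∃ (w x : ℝ) (s : ℕ), M u v = w ∧ WW M s v u x ∧ w + x = r := by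
  subst hW
  rw [ww_append, ww_cons] at hr
  obtain ⟨p, y, hp, hy, rfl⟩ := add_eq_coe' hr
  obtain ⟨w, q, hw, hq, rfl⟩ := add_eq_coe' hy
  have huv := hM u v (zip_mem u v P Q)
  have hMQ : ∀ a b, (a, b) ∈ (v :: Q).zip Q → M a b = B a b := by
    intro a b hab
    obtain ⟨P', Q', h'⟩ := zip_split a b (v :: Q) hab
    apply hM
    rw [h', show P ++ u :: (P' ++ a :: b :: Q') = (P ++ u :: P') ++ a :: b :: Q' by simp]
    exact zip_mem _ _ _ _
  obtain ⟨z, hz, hW1⟩ := WW.of_list Q v q hMQ hq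
  have hlast : (P ++ u :: v :: Q).getLast? = some z := by
    rw [List.getLast?_append, List.getLast?_cons_cons, hz]; rfl
  rw [hlast] at hhl
  obtain ⟨L, hL⟩ : ∃ L, P ++ [u] = z :: L := by
    cases P with
    | nil => simp at hhl; exact ⟨[], by simp [hhl]⟩
    | cons c P => simp at hhl; exact ⟨P ++ [u], by simp [hhl]⟩
  have hMP : ∀ a b, (a, b) ∈ (z :: L).zip L → M a b = B a b := by
    intro a b hab
    obtain ⟨P', Q', h'⟩ := zip_split a b (z :: L) hab
    apply hM
    rw [show P ++ u :: v :: Q = (P ++ [u]) ++ v :: Q by simp, hL, h',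
      show (P' ++ a :: b :: Q') ++ v :: Q = P' ++ a :: b :: (Q' ++ v :: Q) by simp]
    exact zip_mem _ _ _ _
  rw [hL] at hp
  obtain ⟨z', hz', hW2⟩ := WW.of_list L z p hMP hp
  have : z' = u := by
    rw [← hL] at hz'; simp at hz'; exact hz'.symm
  subst this
  exact ⟨w, q + p, _, huv.trans hw, hW1.append hW2, by ring⟩

theorem crit_rev_edge {A : MPMat n} {lam : ℝ} {u v : Fin n} {w : ℝ}
    (h : critK A lam u v = w) : ∃ s, WW (critK A lam) s v u (-w) := by
  obtain ⟨W, hW, hm, huv⟩ := (csrS_coe h).1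
  obtain ⟨P, Q, hPQ⟩ := zip_split u v W huv
  obtain ⟨w', x, s, h1, h2, h3⟩ := rotate (M := critK A lam) (B := shiftMat A (-lam)) (r := 0)
    hPQ hW.2.2.1
    (fun a b hab => csrS_edge (show critEdges A lam a b from ⟨W, hW, hm, hab⟩))
    (by rw [ww_shift, hm, ← WithBot.coe_add]; congr 1; ring)
  rw [h] at h1
  have : w = w' := by exact_mod_cast h1
  subst this
  exact ⟨s, by rwa [show -w = x by linarith]⟩

theorem crit_rev {A : MPMat n} {lam : ℝ} {s : ℕ} {u v : Fin n} {x : ℝ}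
    (h : WW (critK A lam) s u v x) : ∃ s', WW (critK A lam) s' v u (-x) := by
  induction h with
  | nil i => exact ⟨0, by simpa using WW.nil i⟩
  | cons h t ih =>
    obtain ⟨s1, h1⟩ := ih
    obtain ⟨s2, h2⟩ := crit_rev_edge h
    exact ⟨_, by simpa [add_comm] using h1.append h2⟩

theorem crit_closed {A : MPMat n} {lam : ℝ} (hlam : IsMaxCycleMean A lam) {s : ℕ} {u : Fin n}
    {x : ℝ} (h : WW (critK A lam) s u u x) : x = 0 := by
  obtain ⟨s', h'⟩ := crit_rev h
  have h1 := closed_le hlam (WW.toB h)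
  have h2 := closed_le hlam (WW.toB h')
  linarith

theorem walk_WW {A : MPMat n} {lam : ℝ} {G : SubD n} (hG : SubLE G (critSub A lam))
    {W : List (Fin n)} (hW : IsWalkIn G W) {u v : Fin n} (hu : W.head? = some u)
    (hv : W.getLast? = some v) : ∃ x, WW (csrS A lam G) (elen W) u v x := by
  have hE : ∀ a b, (a, b) ∈ W.zip W.tail → G.edge a b := fun a b h =>
    chain_zip hW.2.2 h
  obtain ⟨x, hx⟩ := ww_ne_bot (M := shiftMat A (-lam)) W (fun a b h =>
    (shift_ne_bot _ _ _ _).2 (crit_ne_bot (hG.2 _ _ (hE a b h))))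
  cases W with
  | nil => simp at hu
  | cons a L =>
    simp at hu; subst hu
    obtain ⟨b, hb, h⟩ := WW.of_list (M := csrS A lam G) L a x
      (fun c d h => csrS_edge (hE c d h)) hx
    rw [hb] at hv
    cases hv
    exact ⟨x, by simpa [elen] using h⟩

theorem edge_verts {G : SubD n} (hcr : CompletelyReducible G) {u v : Fin n} (h : G.edge u v) :
    u ∈ G.verts ∧ v ∈ G.verts := by
  obtain ⟨W, hW, h1, h2⟩ := hcr u v h
  exact ⟨hW.2.1 _ (List.mem_of_getLast? h2), hW.2.1 _ (List.mem_of_head? h1)⟩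

theorem WW.verts {A : MPMat n} {lam : ℝ} {G : SubD n} (hcr : CompletelyReducible G) {s : ℕ}
    {u v : Fin n} {x : ℝ} (h : WW (csrS A lam G) s u v x) (hu : u ∈ G.verts) : v ∈ G.verts := by
  induction h with
  | nil i => exact hu
  | cons h t ih => exact ih (edge_verts hcr (csrS_coe h).1).2

theorem WW.toWalk {A : MPMat n} {lam : ℝ} {G : SubD n} (hcr : CompletelyReducible G) {s : ℕ}
    {u v : Fin n} {x : ℝ} (h : WW (csrS A lam G) s u v x) (hu : u ∈ G.verts) :
    ∃ L : List (Fin n), IsWalkIn G (u :: L) ∧ (u :: L).getLast? = some v ∧ L.length = s := by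
  induction h with
  | nil i => exact ⟨[], ⟨by simp, by simpa using hu, List.isChain_singleton _⟩, by simp, rfl⟩
  | @cons s i j k w x h t ih =>
    have he := (csrS_coe h).1
    obtain ⟨L, hW, hl, hs⟩ := ih (edge_verts hcr he).2
    refine ⟨j :: L, ⟨by simp, ?_, List.isChain_cons_cons.2 ⟨he, hW.2.2⟩⟩, by simpa using hl,
      by simp [hs]⟩
    intro v hv
    rcases List.mem_cons.1 hv with rfl | hv
    · exact hu
    · exact hW.2.1 v hv

theorem exists_closed {A : MPMat n} {lam : ℝ} {G : SubD n} (hG : SubLE G (critSub A lam))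
    (hnt : NoTrivialScc G) {v : Fin n} (hv : v ∈ G.verts) :
    ∃ s x, 0 < s ∧ WW (csrS A lam G) s v v x := by
  obtain ⟨W, hW, hm⟩ := hnt v hv
  have hE : ∀ a b, (a, b) ∈ W.zip W.tail → G.edge a b := fun a b h =>
    chain_zip hW.1.2.2 h
  obtain ⟨r, hr⟩ := ww_ne_bot (M := shiftMat A (-lam)) W (fun a b h =>
    (shift_ne_bot _ _ _ _).2 (crit_ne_bot (hG.2 _ _ (hE a b h))))
  obtain ⟨b, P, Q, hPQ⟩ : ∃ b P Q, W = P ++ v :: b :: Q := by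
    obtain ⟨P, Q, hPQ⟩ := List.append_of_mem hm
    cases Q with
    | cons b Q => exact ⟨b, P, Q, hPQ⟩
    | nil =>
      have hlen := hW.2.1
      have hhl := hW.2.2.1
      rw [hPQ] at hlen hhl
      match P, hlen, hhl with
      | c :: P, hlen, hhl =>
        rw [List.getLast?_append] at hhl
        simp at hhl
        subst hhl
        cases P with
        | nil => exact ⟨c, [], [], by simpa using hPQ⟩
        | cons d P => exact ⟨d, [], P ++ [c], by simpa using hPQ⟩
  obtain ⟨w, x, s, h1, h2, -⟩ := rotate (M := csrS A lam G) hPQ hW.2.2.1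
    (fun a b h => csrS_edge (hE a b h)) hr
  exact ⟨s + 1, w + x, by omega, .cons h1 h2⟩

theorem setGcd_eq (S : Set ℕ) : setGcd S = Nat.setGcd S := by
  have hmem : Nat.setGcd S ∈ {d | (∀ s ∈ S, d ∣ s) ∧ ∀ e, (∀ s ∈ S, e ∣ s) → e ∣ d} :=
    ⟨fun s hs => Nat.setGcd_dvd_of_mem hs, fun e he => Nat.dvd_setGcd_iff.2 he⟩
  have h := Nat.sInf_mem ⟨_, hmem⟩
  exact Nat.dvd_antisymm (hmem.2 _ h.1) (h.2 _ hmem.1)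

theorem cyc_spec (G : SubD n) : 0 < graphCyclicity G ∧
    ∀ v ∈ G.verts, 0 < sccCyclicity G v → sccCyclicity G v ∣ graphCyclicity G := by
  have hne : {m | 0 < m ∧ ∀ s ∈ {c | ∃ v ∈ G.verts, c = sccCyclicity G v ∧ 0 < c}, s ∣ m}.Nonempty := by
    refine ⟨∏ v : Fin n, (if 0 < sccCyclicity G v then sccCyclicity G v else 1), ?_, ?_⟩
    · apply Finset.prod_pos
      intro v _
      split_ifs with h
      · exact h
      · exact one_pos
    · rintro s ⟨v, -, rfl, hs⟩
      have := Finset.dvd_prod_of_mem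
        (fun v : Fin n => if 0 < sccCyclicity G v then sccCyclicity G v else 1) (Finset.mem_univ v)
      simpa only [hs, if_true] using this
  have h := Nat.sInf_mem hne
  exact ⟨h.1, fun v hv h0 => h.2 _ ⟨v, hv, rfl, h0⟩⟩

theorem large_closed {A : MPMat n} {lam : ℝ} (hlam : IsMaxCycleMean A lam) {G : SubD n}
    (hG : SubLE G (critSub A lam))
    (hcr : CompletelyReducible G) (hnt : NoTrivialScc G) {v : Fin n} (hv : v ∈ G.verts) :
    ∃ N, ∀ m ≥ N, graphCyclicity G ∣ m → WW (csrS A lam G) m v v 0 := by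
  set S := {l | 0 < l ∧ ∃ W, IsClosedWalkAt G v W ∧ elen W = l} with hS
  obtain ⟨N, hN⟩ := Nat.exists_mem_closure_of_ge S
  have hcyc : sccCyclicity G v = Nat.setGcd S := setGcd_eq S
  obtain ⟨s, x, hs, hW⟩ := exists_closed (lam := lam) hG hnt hv
  obtain ⟨L, hL, hl, hlen⟩ := hW.toWalk hcr hv
  have hsS : s ∈ S := ⟨hs, v :: L, ⟨hL, rfl, hl⟩, by simp [elen, hlen]⟩
  have hpos : 0 < sccCyclicity G v := by
    rw [hcyc]; exact Nat.pos_of_dvd_of_pos (Nat.setGcd_dvd_of_mem hsS) hs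
  refine ⟨N, fun m hm hd => ?_⟩
  have hmem := hN m hm (hcyc ▸ ((cyc_spec G).2 v hv hpos).trans hd)
  refine AddSubmonoid.closure_induction (motive := fun m _ => WW (csrS A lam G) m v v 0)
    ?_ (.nil v) ?_ hmem
  · rintro l ⟨-, W, hW, rfl⟩
    obtain ⟨x, hx⟩ := walk_WW (lam := lam) hG hW.1 hW.2.1 hW.2.2
    have := crit_closed hlam (hx.toK hG)
    subst this; exact hx
  · intro a b _ _ ha hb
    simpa using ha.append hb

theorem le_csr {A : MPMat n} {lam : ℝ} (hlam : IsMaxCycleMean A lam) {G : SubD n}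
    (hG : SubLE G (critSub A lam))
    (hcr : CompletelyReducible G) (hnt : NoTrivialScc G) {k : Fin n} (hk : k ∈ G.verts)
    {s1 s2 t : ℕ} {i j : Fin n} {x y : ℝ} (h1 : WW (shiftMat A (-lam)) s1 i k x)
    (h2 : WW (shiftMat A (-lam)) s2 k j y) (hmod : s1 + s2 ≡ t [MOD graphCyclicity G]) :
    ((x + y : ℝ) : WithBot ℝ) ≤ csr A lam G t i j := by
  obtain ⟨N, hN⟩ := large_closed hlam hG hcr hnt hk
  have hγ := (cyc_spec G).1
  obtain ⟨g, hg⟩ : ∃ g, graphCyclicity G = g + 1 := ⟨graphCyclicity G - 1, by omega⟩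
  set γ := graphCyclicity G
  obtain ⟨r2, hr2⟩ : ∃ r2, g * s1 + t + r2 = γ * (g * s1 + t + N) :=
    ⟨γ * (g * s1 + t + N) - (g * s1 + t), by
      have : 1 * (g * s1 + t + N) ≤ γ * (g * s1 + t + N) := Nat.mul_le_mul_right _ hγ
      omega⟩
  have hcl := hN (γ * (g * s1 + t + N)) (by
      have : 1 * (g * s1 + t + N) ≤ γ * (g * s1 + t + N) := Nat.mul_le_mul_right _ hγ
      show N ≤ _
      omega) ⟨_, rfl⟩
  rw [← hr2] at hcl
  obtain ⟨q, a', c, ha', hc, hac⟩ := hcl.split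
  obtain ⟨p, a, b, ha, hb, rfl⟩ := ha'.split
  have hp := ha.verts hcr hk
  have hq := hb.verts hcr hp
  have e1 : s1 + g * s1 = γ * s1 := by rw [hg]; ring
  obtain ⟨β, e2⟩ : γ ∣ r2 + s2 := by
    have : (γ * s1) + (r2 + s2) ≡ 0 + 0 [MOD γ] := by
      have h3 : (s1 + s2) + (g * s1 + r2) ≡ t + (g * s1 + r2) [MOD γ] := hmod.add_right _
      have h4 : t + (g * s1 + r2) ≡ 0 [MOD γ] := by
        rw [show t + (g * s1 + r2) = g * s1 + t + r2 by ring, hr2]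
        exact (Nat.modEq_zero_iff_dvd.2 ⟨_, rfl⟩)
      rw [← e1, show s1 + g * s1 + (r2 + s2) = (s1 + s2) + (g * s1 + r2) by ring]
      exact h3.trans h4
    have h5 : γ * s1 ≡ 0 [MOD γ] := Nat.modEq_zero_iff_dvd.2 ⟨_, rfl⟩
    exact Nat.modEq_zero_iff_dvd.1 (Nat.ModEq.add_left_cancel h5 this)
  have hC := h1.append ha.toB
  rw [e1] at hC
  have hR := hc.toB.append h2
  rw [e2] at hR
  have hC' : ((x + a : ℝ) : WithBot ℝ) ≤ csrC A lam G i p := by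
    simp only [csrC, hp, if_true]; exact le_csrM hlam G hC
  have hR' : ((c + y : ℝ) : WithBot ℝ) ≤ csrR A lam G q j := by
    simp only [csrR, hq, if_true]; exact le_csrM hlam G hR
  calc ((x + y : ℝ) : WithBot ℝ) = (((x + a : ℝ) : WithBot ℝ) + (b : WithBot ℝ))
        + ((c + y : ℝ) : WithBot ℝ) := by
        rw [← WithBot.coe_add, ← WithBot.coe_add]; congr 1; linarith
    _ ≤ (csrC A lam G i p + mpPow (csrS A lam G) t p q) + csrR A lam G q j := by
        gcongr
        exact hb.le_pow
    _ ≤ mpMul (csrC A lam G) (mpPow (csrS A lam G) t) i q + csrR A lam G q j := by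
        gcongr
        exact Finset.le_sup (f := fun p => csrC A lam G i p + mpPow (csrS A lam G) t p q)
          (Finset.mem_univ p)
    _ ≤ _ := Finset.le_sup (f := fun q => mpMul (csrC A lam G) (mpPow (csrS A lam G) t) i q
          + csrR A lam G q j) (Finset.mem_univ q)

theorem reach_K {A : MPMat n} {lam : ℝ} {u v : Fin n} (h : ReachIn (critSub A lam) u v) :
    ∃ s x, WW (critK A lam) s u v x := by
  obtain ⟨W, hW, h1, h2⟩ := h
  obtain ⟨x, hx⟩ := walk_WW (lam := lam) ⟨subset_rfl, fun _ _ h => h⟩ hW h1 h2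
  exact ⟨_, x, hx⟩

theorem csr_le {A : MPMat n} {lam : ℝ}
    (hlam : IsMaxCycleMean A lam)
    {G G' : SubD n}
    (hGle : SubLE G (critSub A lam)) (hGcr : CompletelyReducible G)
    (hGnt : NoTrivialScc G)
    (hGle' : SubLE G' (critSub A lam)) (hGcr' : CompletelyReducible G')
    (hGnt' : NoTrivialScc G')
    (hiff : ∀ w ∈ critNodes A lam,
      (∃ v ∈ G.verts, SccEq (critSub A lam) w v) →
      (∃ v ∈ G'.verts, SccEq (critSub A lam) w v))
    (t : ℕ) (i j : Fin n) : csr A lam G t i j ≤ csr A lam G' t i j := by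
  have main : ∀ (k l : Fin n) (a b : ℕ) (x y z : ℝ), k ∈ G.verts →
      WW (shiftMat A (-lam)) (graphCyclicity G * a) i k x → WW (csrS A lam G) t k l y →
      WW (shiftMat A (-lam)) (graphCyclicity G * b) l j z →
      ((x + y + z : ℝ) : WithBot ℝ) ≤ csr A lam G' t i j := by
    intro k l a b x y z hk hx hy hz
    have hkc : k ∈ critNodes A lam := hGle.1 hk
    have hrefl : ReachIn (critSub A lam) k k :=
      ⟨[k], ⟨by simp, by simpa using hGle.1 hk, List.isChain_singleton _⟩, rfl, rfl⟩
    obtain ⟨k', hk', hr1, hr2⟩ := hiff k hkc ⟨k, hk, hrefl, hrefl⟩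
    obtain ⟨d1, u, hu⟩ := reach_K hr1
    obtain ⟨d2, v, hv⟩ := reach_K hr2
    have hcl := hu.append hv
    have huv := crit_closed hlam hcl
    rw [huv] at hcl
    obtain ⟨N, hN⟩ := large_closed hlam hGle hGcr hGnt hk
    have hγ := (cyc_spec G).1
    have hγ' := (cyc_spec G').1
    obtain ⟨g, hg⟩ : ∃ g, graphCyclicity G' = g + 1 := ⟨graphCyclicity G' - 1, by omega⟩
    set γ := graphCyclicity G
    have he := hcl.rep g
    have hc := hN (γ * (g * (a + b) + (g + 1) * N)) (by
      have h1 : 1 * (g * (a + b) + (g + 1) * N) ≤ γ * (g * (a + b) + (g + 1) * N) :=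
        Nat.mul_le_mul_right _ hγ
      have h2 : (g + 1) * N = g * N + N := by ring
      show N ≤ _
      have := Nat.zero_le (g * (a + b))
      have := Nat.zero_le (g * N)
      omega) ⟨_, rfl⟩
    have w1 := (hx.append hc.toB).append (WW.toB hu)
    have w2 := ((WW.toB hv).append (WW.toB he)).append (hy.toB.append hz)
    have := le_csr hlam hGle' hGcr' hGnt' hk' (t := t) w1 w2 (by
      rw [hg, show γ * a + γ * (g * (a + b) + (g + 1) * N) + d1
        + (d2 + (d1 + d2) * g + (t + γ * b))
        = t + (g + 1) * (γ * (a + b) + γ * N + d1 + d2) by ring]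
      simp [Nat.ModEq])
    refine le_trans (le_of_eq ?_) this
    congr 1
    linarith
  show Finset.univ.sup (fun l => mpMul (csrC A lam G) (mpPow (csrS A lam G) t) i l
    + csrR A lam G l j) ≤ _
  refine Finset.sup_le fun l _ => ?_
  cases hl : mpMul (csrC A lam G) (mpPow (csrS A lam G) t) i l with
  | bot => simp
  | coe r =>
    obtain ⟨k, hk⟩ := sup_eq_coe (f := fun k => csrC A lam G i k + mpPow (csrS A lam G) t k l) hl
    rw [← hk]
    simp only [csrC, csrR]
    split_ifs with h1 h2 h2
    · cases hp : mpPow (csrS A lam G) t k l with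
      | bot => simp
      | coe y =>
        rw [add_assoc]
        refine csrM_add_le G fun a x hx => ?_
        rw [← add_assoc, add_comm]
        refine csrM_add_le G fun b z hz => ?_
        have := main k l a b x y z h1 hx (.of_pow hp) hz
        rwa [WithBot.coe_add, WithBot.coe_add, add_comm] at this
    all_goals simp

end Helpers

/-- `CS^tR` only depends on the set of s.c.c.'s of `𝒞(A)`
intersecting the completely reducible subgraph. -/
theorem csr_depends_only_on_met_sccs {n : ℕ} (A : MPMat n) (lam : ℝ)
    (hlam : IsMaxCycleMean A lam)
    (G G' : SubD n)
    (hGle : SubLE G (critSub A lam)) (hGcr : CompletelyReducible G)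
    (hGnt : NoTrivialScc G)
    (hGle' : SubLE G' (critSub A lam)) (hGcr' : CompletelyReducible G')
    (hGnt' : NoTrivialScc G')
    (hiff : ∀ w ∈ critNodes A lam,
      (∃ v ∈ G.verts, SccEq (critSub A lam) w v) ↔
      (∃ v ∈ G'.verts, SccEq (critSub A lam) w v)) :
    ∀ (t : ℕ) (i j : Fin n), csr A lam G t i j = csr A lam G' t i j := by
  intro t i j
  exact le_antisymm
    (csr_le hlam hGle hGcr hGnt hGle' hGcr' hGnt' (fun w hw => (hiff w hw).1) t i j)
    (csr_le hlam hGle' hGcr' hGnt' hGle hGcr hGnt (fun w hw => (hiff w hw).2) t i j)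

end MaxPlus
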